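/- arXiv:1804.10043 — 2 statements merged into one kernel-verified Lean document; each statement's English description precedes it below -/
import Mathlib

section
/- For all real s > 0 and x > 0, e^{−sx} + sx − 1 = ∫₀^∞ (1 − e^{−s²t/2}) (1 − e^{−x²/(2t)}) · x / √(2π t³) dt. -/
open MeasureTheory Real

/-- The unnormalised error function `y ↦ ∫₀^y e^{-v²/2} dv`. -/
noncomputable def gaussPrimitive (y : ℝ) : ℝ :=
  ∫ v in (0 : ℝ)..y, Real.exp (-(1 / 2) * v ^ 2)

lemma hasDerivAt_gaussPrimitive (y : ℝ) :
    HasDerivAt gaussPrimitive (Real.exp (-(1 / 2) * y ^ 2)) y := by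
  have hc : Continuous fun v : ℝ => Real.exp (-(1 / 2) * v ^ 2) := by fun_prop
  exact intervalIntegral.integral_hasDerivAt_right (hc.intervalIntegrable _ _)
    hc.stronglyMeasurable.stronglyMeasurableAtFilter hc.continuousAt

lemma gaussPrimitive_zero : gaussPrimitive 0 = 0 := by
  simp [gaussPrimitive]

lemma gaussPrimitive_neg (y : ℝ) : gaussPrimitive (-y) = -gaussPrimitive y := by
  have h := intervalIntegral.integral_comp_neg (a := 0) (b := y)
    fun v : ℝ => Real.exp (-(1 / 2) * v ^ 2)
  simp only [neg_sq, neg_zero] at h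
  rw [gaussPrimitive, gaussPrimitive, h, intervalIntegral.integral_symm]

lemma tendsto_gaussPrimitive_atTop :
    Filter.Tendsto gaussPrimitive Filter.atTop (nhds (√(2 * π) / 2)) := by
  have h := intervalIntegral_tendsto_integral_Ioi (μ := volume) (0 : ℝ)
    (integrable_exp_neg_mul_sq (b := 1 / 2) (by norm_num)).integrableOn Filter.tendsto_id
  rw [integral_gaussian_Ioi, show π / (1 / 2) = 2 * π by ring] at h
  exact h

lemma tendsto_gaussPrimitive_atBot :
    Filter.Tendsto gaussPrimitive Filter.atBot (nhds (-(√(2 * π) / 2))) := by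
  refine (tendsto_gaussPrimitive_atTop.comp Filter.tendsto_neg_atBot_atTop).neg.congr fun y => ?_
  simp [gaussPrimitive_neg]

/-- A primitive, in the variable `r = √t`, of the compensated kernel multiplied by `√(2π)`. -/
noncomputable def compensatedPrimitive (s x r : ℝ) : ℝ :=
  -2 * x * ((1 - Real.exp (-s ^ 2 * r ^ 2 / 2)) / r) + 2 * s * x * gaussPrimitive (s * r)
    + 2 * gaussPrimitive (x / r) + Real.exp (-s * x) * gaussPrimitive (s * r - x / r)
    - Real.exp (s * x) * gaussPrimitive (s * r + x / r)

lemma hasDerivAt_compensatedPrimitive (s x : ℝ) {r : ℝ} (hr : r ≠ 0) :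
    HasDerivAt (compensatedPrimitive s x)
      ((1 - Real.exp (-s ^ 2 * r ^ 2 / 2)) * (1 - Real.exp (-x ^ 2 / (2 * r ^ 2))) *
        (2 * x / r ^ 2)) r := by
  have hid := hasDerivAt_id' r
  have hA : HasDerivAt (fun r : ℝ => Real.exp (-s ^ 2 * r ^ 2 / 2))
      (Real.exp (-s ^ 2 * r ^ 2 / 2) * (-s ^ 2 * r)) r := by
    refine ((((hasDerivAt_pow 2 r).const_mul (-s ^ 2)).div_const 2).exp).congr_deriv ?_
    push_cast
    ring
  have hsr : HasDerivAt (fun r : ℝ => s * r) s r := by simpa using hid.const_mul s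
  have hxr : HasDerivAt (fun r : ℝ => x / r) (-x / r ^ 2) r := by
    refine ((hasDerivAt_const r x).div hid hr).congr_deriv ?_
    ring
  have h1 := ((hA.const_sub 1).div hid hr).const_mul (-2 * x)
  have h2 := ((hasDerivAt_gaussPrimitive (s * r)).comp r hsr).const_mul (2 * s * x)
  have h3 := ((hasDerivAt_gaussPrimitive (x / r)).comp r hxr).const_mul 2
  have h4 := ((hasDerivAt_gaussPrimitive (s * r - x / r)).comp r (hsr.sub hxr)).const_mul
    (Real.exp (-s * x))
  have h5 := ((hasDerivAt_gaussPrimitive (s * r + x / r)).comp r (hsr.add hxr)).const_mul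
    (Real.exp (s * x))
  refine ((((h1.add h2).add h3).add h4).sub h5).congr_deriv ?_
  have e2 : Real.exp (-(1 / 2) * (s * r) ^ 2) = Real.exp (-s ^ 2 * r ^ 2 / 2) := by
    congr 1; ring
  have e3 : Real.exp (-(1 / 2) * (x / r) ^ 2) = Real.exp (-x ^ 2 / (2 * r ^ 2)) := by
    congr 1; field_simp
  have e4 : Real.exp (-s * x) * Real.exp (-(1 / 2) * (s * r - x / r) ^ 2) =
      Real.exp (-s ^ 2 * r ^ 2 / 2) * Real.exp (-x ^ 2 / (2 * r ^ 2)) := by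
    rw [← Real.exp_add, ← Real.exp_add]; congr 1; field_simp; ring
  have e5 : Real.exp (s * x) * Real.exp (-(1 / 2) * (s * r + x / r) ^ 2) =
      Real.exp (-s ^ 2 * r ^ 2 / 2) * Real.exp (-x ^ 2 / (2 * r ^ 2)) := by
    rw [← Real.exp_add, ← Real.exp_add]; congr 1; field_simp; ring
  rw [← mul_assoc (Real.exp (-s * x)), e4, ← mul_assoc (Real.exp (s * x)), e5, e2, e3]
  field_simp
  ring

open Filter Topology in
lemma tendsto_compensatedPrimitive_atTop {s : ℝ} (hs : 0 < s) (x : ℝ) :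
    Tendsto (compensatedPrimitive s x) atTop
      (𝓝 (√(2 * π) * (s * x + Real.exp (-s * x) / 2 - Real.exp (s * x) / 2))) := by
  have hsr : Tendsto (fun r : ℝ => s * r) atTop atTop := tendsto_id.const_mul_atTop hs
  have hxr : Tendsto (fun r : ℝ => x / r) atTop (𝓝 0) := tendsto_const_nhds.div_atTop tendsto_id
  have hA : Tendsto (fun r : ℝ => Real.exp (-s ^ 2 * r ^ 2 / 2)) atTop (𝓝 0) := by
    refine Real.tendsto_exp_atBot.comp ?_
    have h : Tendsto (fun r : ℝ => s ^ 2 / 2 * r ^ 2) atTop atTop :=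
      (tendsto_pow_atTop two_ne_zero).const_mul_atTop (by positivity)
    refine (tendsto_neg_atTop_atBot.comp h).congr fun r => ?_
    simp only [Function.comp_apply]
    ring
  have h1 := ((tendsto_const_nhds (x := (1 : ℝ)).sub hA).div_atTop tendsto_id).const_mul (-2 * x)
  have h2 := (tendsto_gaussPrimitive_atTop.comp hsr).const_mul (2 * s * x)
  have h3 := ((hasDerivAt_gaussPrimitive 0).continuousAt.tendsto.comp hxr).const_mul 2
  have h4 := (tendsto_gaussPrimitive_atTop.comp (hsr.atTop_add hxr.neg)).const_mul
    (Real.exp (-s * x))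
  have h5 := (tendsto_gaussPrimitive_atTop.comp (hsr.atTop_add hxr)).const_mul (Real.exp (s * x))
  have h := ((((h1.add h2).add h3).add h4).sub h5).congr
    (f₂ := compensatedPrimitive s x) fun r => by
      simp only [compensatedPrimitive, Function.comp_apply, id, sub_eq_add_neg]
  rw [gaussPrimitive_zero] at h
  convert h using 2
  ring

open Filter Topology in
lemma tendsto_compensatedPrimitive_zero (s : ℝ) {x : ℝ} (hx : 0 < x) :
    Tendsto (compensatedPrimitive s x) (𝓝[>] 0)
      (𝓝 (√(2 * π) * (1 - Real.exp (-s * x) / 2 - Real.exp (s * x) / 2))) := by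
  have hsr : Tendsto (fun r : ℝ => s * r) (𝓝[>] 0) (𝓝 0) := by
    have h : Continuous fun r : ℝ => s * r := by fun_prop
    simpa using (h.tendsto 0).mono_left nhdsWithin_le_nhds
  have hxr : Tendsto (fun r : ℝ => x / r) (𝓝[>] 0) atTop := by
    simpa only [div_eq_mul_inv] using tendsto_inv_nhdsGT_zero.const_mul_atTop hx
  have hA : Tendsto (fun r : ℝ => (1 - Real.exp (-s ^ 2 * r ^ 2 / 2)) / r) (𝓝[>] 0) (𝓝 0) := by
    have hb : Tendsto (fun r : ℝ => s ^ 2 / 2 * r) (𝓝[>] 0) (𝓝 0) := by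
      have h : Continuous fun r : ℝ => s ^ 2 / 2 * r := by fun_prop
      simpa using (h.tendsto 0).mono_left nhdsWithin_le_nhds
    refine tendsto_of_tendsto_of_tendsto_of_le_of_le' tendsto_const_nhds hb ?_ ?_
    · filter_upwards [self_mem_nhdsWithin] with r hr
      have hr : 0 < r := hr
      have : Real.exp (-s ^ 2 * r ^ 2 / 2) ≤ 1 :=
        Real.exp_le_one_iff.2 (by nlinarith [sq_nonneg (s * r)])
      exact div_nonneg (by linarith) hr.le
    · filter_upwards [self_mem_nhdsWithin] with r hr
      have hr : 0 < r := hr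
      rw [div_le_iff₀ hr]
      have := Real.add_one_le_exp (-s ^ 2 * r ^ 2 / 2)
      nlinarith
  have h1 := hA.const_mul (-2 * x)
  have h2 := ((hasDerivAt_gaussPrimitive 0).continuousAt.tendsto.comp hsr).const_mul (2 * s * x)
  have h3 := (tendsto_gaussPrimitive_atTop.comp hxr).const_mul 2
  have h4 := (tendsto_gaussPrimitive_atBot.comp
    (hsr.add_atBot (tendsto_neg_atTop_atBot.comp hxr))).const_mul (Real.exp (-s * x))
  have h5 := (tendsto_gaussPrimitive_atTop.comp (hsr.add_atTop hxr)).const_mul (Real.exp (s * x))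
  have h := ((((h1.add h2).add h3).add h4).sub h5).congr
    (f₂ := compensatedPrimitive s x) fun r => by
      simp only [compensatedPrimitive, Function.comp_apply, sub_eq_add_neg]
  rw [gaussPrimitive_zero] at h
  convert h using 2
  ring

open Filter Topology in
/-- Fundamental theorem of calculus on `(a, ∞)` for a nonnegative derivative, with a one-sided
limit at the finite endpoint. -/
lemma integral_Ioi_of_hasDerivAt_of_nonneg_of_tendsto {f f' : ℝ → ℝ} {a l m : ℝ}
    (hderiv : ∀ t ∈ Set.Ioi a, HasDerivAt f (f' t) t) (hnonneg : ∀ t ∈ Set.Ioi a, 0 ≤ f' t)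
    (hl : Tendsto f (𝓝[>] a) (𝓝 l)) (hm : Tendsto f atTop (𝓝 m)) :
    ∫ t in Set.Ioi a, f' t = m - l := by
  have heq : ∀ t ∈ Set.Ioi a, Function.update f a l t = f t := fun t ht =>
    Function.update_of_ne (ne_of_gt ht) _ _
  have h := integral_Ioi_of_hasDerivAt_of_nonneg (g := Function.update f a l) (g' := f')
    (a := a) (l := m) ?_ ?_ hnonneg ?_
  · simpa using h
  · rw [continuousWithinAt_update_same]
    simpa using hl
  · intro t ht
    refine (hderiv t ht).congr_of_eventuallyEq ?_
    filter_upwards [Ioi_mem_nhds ht] with u hu using heq u hu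
  · refine hm.congr' ?_
    filter_upwards [Ioi_mem_atTop a] with u hu using (heq u hu).symm

open Filter Topology in
/-- For all real `s > 0` and `x > 0`,
`e^{−sx} + sx − 1 = ∫₀^∞ (1 − e^{−s²t/2}) (1 − e^{−x²/(2t)}) · x / √(2π t³) dt`. -/
theorem exp_compensated_integral_repr (s x : ℝ) (hs : 0 < s) (hx : 0 < x) :
    Real.exp (-s * x) + s * x - 1 =
      ∫ t in Set.Ioi (0 : ℝ),
        (1 - Real.exp (-s ^ 2 * t / 2)) * (1 - Real.exp (-x ^ 2 / (2 * t))) *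
          x / Real.sqrt (2 * Real.pi * t ^ 3) := by
  have hc : 0 < √(2 * π) := by positivity
  have hsqrt : Tendsto Real.sqrt (𝓝[>] 0) (𝓝[>] 0) := by
    refine tendsto_nhdsWithin_iff.2 ⟨?_, ?_⟩
    · simpa using (Real.continuous_sqrt.tendsto 0).mono_left nhdsWithin_le_nhds
    · filter_upwards [self_mem_nhdsWithin] with t ht using Real.sqrt_pos.2 ht
  rw [integral_Ioi_of_hasDerivAt_of_nonneg_of_tendsto
    (f := fun t => compensatedPrimitive s x √t / √(2 * π)) ?_ ?_
    (((tendsto_compensatedPrimitive_zero s hx).comp hsqrt).div_const _)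
    (((tendsto_compensatedPrimitive_atTop hs x).comp Real.tendsto_sqrt_atTop).div_const _)]
  · field_simp
    ring
  · intro t ht
    have ht : 0 < t := ht
    have hr : 0 < √t := Real.sqrt_pos.2 ht
    refine (((hasDerivAt_compensatedPrimitive s x hr.ne').comp t
      (Real.hasDerivAt_sqrt ht.ne')).div_const _).congr_deriv ?_
    have h3 : √(2 * π * t ^ 3) = √(2 * π) * (t * √t) := by
      rw [Real.sqrt_mul (by positivity : 0 ≤ 2 * π), show t ^ 3 = t ^ 2 * t by ring,
        Real.sqrt_mul (by positivity : 0 ≤ t ^ 2), Real.sqrt_sq ht.le]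
    rw [h3, Real.sq_sqrt ht.le]
    field_simp
  · intro t ht
    have ht : 0 < t := ht
    have hA : Real.exp (-s ^ 2 * t / 2) ≤ 1 :=
      Real.exp_le_one_iff.2 (by nlinarith [mul_nonneg (sq_nonneg s) ht.le])
    have hB : Real.exp (-x ^ 2 / (2 * t)) ≤ 1 :=
      Real.exp_le_one_iff.2 (div_nonpos_of_nonpos_of_nonneg (by nlinarith) (by positivity))
    have := mul_nonneg (sub_nonneg.2 hA) (sub_nonneg.2 hB)
    positivity
end

section
/- For every real α > 0 and every x with 0 ≤ x ≤ π, ∑_{n=0}^∞ cos((2n+1)x) / (α² + (2n+1)²) = (π / (4α)) · sinh(α(π − 2x)/2) / cosh(απ/2). -/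
open Real

/-- A continuous function on `[0, T]` with equal endpoint values and summable Fourier coefficients
is the pointwise sum of its Fourier series. -/
theorem hasSum_fourier_of_continuousOn_Icc {T : ℝ} (hT : 0 < T) {f : ℝ → ℂ} {c : ℤ → ℂ}
    (hf : ContinuousOn f (Set.Icc 0 T)) (hfT : f 0 = f T)
    (hc : ∀ n : ℤ, (∫ t in (0 : ℝ)..T, Complex.exp (-(2 * π * Complex.I * n * t / T)) * f t)
      = T * c n)
    (hs : Summable c) {x : ℝ} (hx : x ∈ Set.Icc 0 T) :
    HasSum (fun n : ℤ ↦ c n * Complex.exp (2 * π * Complex.I * n * x / T)) (f x) := by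
  have : Fact (0 < T) := ⟨hT⟩
  have hT0 : (T : ℂ) ≠ 0 := by exact_mod_cast hT.ne'
  let B : C(AddCircle T, ℂ) := ⟨AddCircle.liftIco T 0 f, AddCircle.liftIco_zero_continuous hfT hf⟩
  have hB : fourierCoeff B = c := by
    ext n
    change fourierCoeff (AddCircle.liftIco T 0 f) n = c n
    rw [fourierCoeff_liftIco_eq, fourierCoeffOn_eq_integral]
    simp only [fourier_coe_apply, smul_eq_mul, zero_add, sub_zero, Int.cast_neg, mul_neg, neg_mul,
      neg_div, hc n, Complex.real_smul]
    push_cast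
    field_simp
  have hsum := has_pointwise_sum_fourier_series_of_summable (f := B) (hB ▸ hs) (x : AddCircle T)
  have hBx : B (x : AddCircle T) = f x := by
    change AddCircle.liftIco T 0 f (x : AddCircle T) = f x
    rcases hx.2.lt_or_eq with h | rfl
    · exact AddCircle.liftIco_coe_apply ⟨hx.1, by rwa [zero_add]⟩
    · rw [AddCircle.coe_period, ← QuotientAddGroup.mk_zero, ← hfT]
      exact AddCircle.liftIco_coe_apply ⟨le_rfl, by rwa [zero_add]⟩
  simpa only [hB, hBx, smul_eq_mul, fourier_coe_apply] using hsum

theorem summable_int_one_div_sq_add_odd_sq (α : ℝ) :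
    Summable (fun n : ℤ ↦ 1 / (α ^ 2 + (2 * (n : ℝ) + 1) ^ 2)) := by
  have h : Summable (fun n : ℕ ↦ 1 / (α ^ 2 + (2 * (n : ℝ) + 1) ^ 2)) := by
    refine Summable.of_nonneg_of_le (fun n ↦ by positivity) (fun n ↦ ?_)
      ((summable_nat_add_iff 1).2 (Real.summable_one_div_nat_pow.2 one_lt_two))
    have hn : (0 : ℝ) ≤ n := n.cast_nonneg
    push_cast
    gcongr
    nlinarith [sq_nonneg α]
  refine Summable.of_nat_of_neg_add_one (by simpa using h) (h.congr fun n ↦ ?_)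
  push_cast
  ring_nf

theorem integral_exp_odd_mul_sinh {α : ℝ} (hα : 0 < α) (n : ℤ) :
    (∫ t in (0 : ℝ)..π, Complex.exp (-((2 * n + 1) * Complex.I * t)) *
        Complex.sinh (α * (π - 2 * t) / 2)) =
      2 * α * Complex.cosh (α * π / 2) / (α ^ 2 + (2 * n + 1) ^ 2) := by
  set m : ℂ := 2 * n + 1 with hm
  have hne (s : ℝ) (hs : s ≠ 0) : (s - m * Complex.I : ℂ) ≠ 0 := by
    intro h
    apply hs
    simpa [hm] using congrArg Complex.re h
  have h₁ := hne α hα.ne'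
  have h₂ : (-α - m * Complex.I : ℂ) ≠ 0 := by
    simpa using hne (-α) (neg_ne_zero.2 hα.ne')
  have hden : (α ^ 2 + m ^ 2 : ℂ) = -((α - m * Complex.I) * (-α - m * Complex.I)) := by
    linear_combination m ^ 2 * Complex.I_sq
  have hexp : Complex.exp (-(m * Complex.I * π)) = -1 := by
    have : -(m * Complex.I * π) = -(π * Complex.I) + (-n : ℤ) * (2 * π * Complex.I) := by
      push_cast
      rw [hm]
      ring
    rw [this, Complex.exp_periodic.int_mul, Complex.exp_neg, Complex.exp_pi_mul_I]
    norm_num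
  set E := Complex.exp (α * π / 2) with hE
  have hE0 : E ≠ 0 := Complex.exp_ne_zero _
  have hEE : Complex.exp (α * π) = E ^ 2 := by
    rw [hE, ← Complex.exp_nat_mul]
    congr 1
    push_cast
    ring
  have hfun (t : ℝ) : Complex.exp (-(m * Complex.I * t)) * Complex.sinh (α * (π - 2 * t) / 2) =
      E / 2 * Complex.exp ((-α - m * Complex.I) * t) -
        E⁻¹ / 2 * Complex.exp ((α - m * Complex.I) * t) := by
    rw [Complex.sinh, hE, ← Complex.exp_neg, mul_div_assoc', mul_sub, ← Complex.exp_add,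
      ← Complex.exp_add, div_mul_eq_mul_div, ← Complex.exp_add, div_mul_eq_mul_div,
      ← Complex.exp_add, ← sub_div]
    ring_nf
  have hint (z : ℂ) (a : ℂ) :
      IntervalIntegrable (fun t : ℝ ↦ a * Complex.exp (z * t)) MeasureTheory.volume 0 π :=
    Continuous.intervalIntegrable (by fun_prop) _ _
  have e₁ : Complex.exp ((-α - m * Complex.I) * π) = -(E ^ 2)⁻¹ := by
    rw [show (-α - m * Complex.I) * (π : ℂ) = -(α * π) + -(m * Complex.I * π) by ring,
      Complex.exp_add, hexp, Complex.exp_neg, hEE]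
    ring
  have e₂ : Complex.exp ((α - m * Complex.I) * π) = -E ^ 2 := by
    rw [show (α - m * Complex.I) * (π : ℂ) = α * π + -(m * Complex.I * π) by ring,
      Complex.exp_add, hexp, hEE]
    ring
  simp_rw [hfun]
  rw [intervalIntegral.integral_sub (hint _ _) (hint _ _), intervalIntegral.integral_const_mul,
    intervalIntegral.integral_const_mul, integral_exp_mul_complex h₂, integral_exp_mul_complex h₁,
    e₁, e₂, hden, Complex.cosh, Complex.exp_neg, ← hE]
  simp only [Complex.ofReal_zero, mul_zero, Complex.exp_zero]
  field_simp
  ring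

theorem hasSum_int_exp_odd_div {α x : ℝ} (hα : 0 < α) (hx : x ∈ Set.Icc 0 π) :
    HasSum (fun n : ℤ ↦ Complex.exp ((2 * n + 1) * Complex.I * x) / (α ^ 2 + (2 * n + 1) ^ 2))
      (π / (2 * α) * (Complex.sinh (α * (π - 2 * x) / 2) / Complex.cosh (α * π / 2))) := by
  have hπ : (π : ℂ) ≠ 0 := by exact_mod_cast pi_ne_zero
  have hα0 : (α : ℂ) ≠ 0 := by exact_mod_cast hα.ne'
  have hcosh : Complex.cosh (α * π / 2) ≠ 0 := by
    exact_mod_cast (Real.cosh_pos (α * π / 2)).ne'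
  have hs : Summable (fun n : ℤ ↦
      2 * α * Complex.cosh (α * π / 2) / π * ((1 / (α ^ 2 + (2 * n + 1) ^ 2) : ℝ) : ℂ)) :=
    (Complex.ofRealCLM.summable (summable_int_one_div_sq_add_odd_sq α)).mul_left _
  have key := hasSum_fourier_of_continuousOn_Icc pi_pos
    (f := fun t : ℝ ↦ Complex.exp (-(Complex.I * t)) * Complex.sinh (α * (π - 2 * t) / 2))
    (by fun_prop) ?_ (fun n ↦ ?_) hs hx
  · convert! key.mul_left (π / (2 * α * Complex.cosh (α * π / 2)) * Complex.exp (Complex.I * x))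
      using 1
    · ext n
      have : Complex.exp ((2 * n + 1) * Complex.I * x) = Complex.exp (Complex.I * x) *
          Complex.exp (2 * π * Complex.I * n * x / π) := by
        rw [← Complex.exp_add]
        congr 1
        field_simp
        ring
      rw [this]
      push_cast
      generalize Complex.cosh (α * π / 2) = C at hcosh ⊢
      field_simp
    · rw [Complex.exp_neg]
      have := Complex.exp_ne_zero (Complex.I * x)
      field_simp
  · have h : (α * (π - 2 * π) / 2 : ℂ) = -(α * (π - 2 * 0) / 2) := by ring
    have h' : Complex.exp (-(Complex.I * π)) = -1 := by
      rw [Complex.exp_neg, mul_comm, Complex.exp_pi_mul_I]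
      norm_num
    simp only [Complex.ofReal_zero, h, Complex.sinh_neg, h']
    simp
  · have h (t : ℝ) : Complex.exp (-(2 * π * Complex.I * n * t / π)) *
        (Complex.exp (-(Complex.I * t)) * Complex.sinh (α * (π - 2 * t) / 2)) =
        Complex.exp (-((2 * n + 1) * Complex.I * t)) * Complex.sinh (α * (π - 2 * t) / 2) := by
      rw [← mul_assoc, ← Complex.exp_add]
      congr 2
      field_simp
      ring
    simp_rw [h]
    rw [integral_exp_odd_mul_sinh hα]
    push_cast
    field_simp

theorem hasSum_cos_odd_div {α x : ℝ} (hα : 0 < α) (hx : x ∈ Set.Icc 0 π) :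
    HasSum (fun n : ℕ ↦ Real.cos ((2 * (n : ℝ) + 1) * x) / (α ^ 2 + (2 * (n : ℝ) + 1) ^ 2))
      (π / (4 * α) * (Real.sinh (α * (π - 2 * x) / 2) / Real.cosh (α * π / 2))) := by
  rw [← Complex.hasSum_ofReal]
  convert! (hasSum_int_exp_odd_div hα hx).nat_add_neg_add_one.div_const 2 using 1
  · ext n
    have h : (2 * (-((n : ℂ) + 1)) + 1) = -(2 * n + 1) := by ring
    push_cast
    rw [h, neg_sq, Complex.cos, ← add_div, div_right_comm]
    ring_nf
  · push_cast
    ring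

/-- For every real `α > 0` and every `x ∈ [0, π]`,
`∑_{n≥0} cos((2n+1)x)/(α² + (2n+1)²) = (π/(4α)) sinh(α(π − 2x)/2)/cosh(απ/2)`. -/
theorem odd_index_cosine_series (α x : ℝ) (hα : 0 < α) (hx0 : 0 ≤ x) (hxπ : x ≤ Real.pi) :
    ∑' n : ℕ, Real.cos ((2 * (n : ℝ) + 1) * x) / (α ^ 2 + (2 * (n : ℝ) + 1) ^ 2) =
      Real.pi / (4 * α) *
        (Real.sinh (α * (Real.pi - 2 * x) / 2) / Real.cosh (α * Real.pi / 2)) :=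
  (hasSum_cos_odd_div hα ⟨hx0, hxπ⟩).tsum_eq
end
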